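/- Fix 0 ≤ k ≤ n and define the positive real numbers Z := ∏_{j=1}^{k} det′(d_{k−j}† ∘ d_{k−j})^{(−1)^j/2}, Z* := ∏_{j=0}^{n−k−1} det′(d_{k+j} ∘ d_{k+j}†)^{(−1)^{j+1}/2}, and T := ∏_{m=0}^{n} det(Δ_m)^{(−1)^m · m/2} (all determinants here are positive real numbers, and the powers are real powers). Then Z · Z*^{−1} = T^{(−1)^{k+1}}. -/

import Mathlib

open LinearMap Module

variable {V : ℕ → Type}

/-- `d_{k-1} ∘ d_{k-1}†`, with the convention `d_{-1} = 0`. -/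
noncomputable def ddAdj [∀ k, NormedAddCommGroup (V k)] [∀ k, InnerProductSpace ℂ (V k)]
    [∀ k, FiniteDimensional ℂ (V k)] (d : ∀ k, V k →ₗ[ℂ] V (k + 1)) :
    ∀ k, V k →ₗ[ℂ] V k
  | 0 => 0
  | k + 1 => (d k).comp (LinearMap.adjoint (d k))

/-- The Laplacian `Δ_k = d_{k-1} ∘ d_{k-1}† + d_k† ∘ d_k` (conventions `d_{-1} = 0`,
and `d_n = 0` is imposed as a hypothesis in the theorems). -/
noncomputable def Lap [∀ k, NormedAddCommGroup (V k)] [∀ k, InnerProductSpace ℂ (V k)]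
    [∀ k, FiniteDimensional ℂ (V k)] (d : ∀ k, V k →ₗ[ℂ] V (k + 1)) (k : ℕ) :
    V k →ₗ[ℂ] V k :=
  ddAdj d k + (LinearMap.adjoint (d k)).comp (d k)

open Classical in
/-- `det′ f`: the determinant of the restriction of `f` to `(ker f)ᗮ` (for `f` mapping
`(ker f)ᗮ` into itself), with `det′ f = 1` when `f = 0`. -/
noncomputable def detPrime {W : Type} [NormedAddCommGroup W] [InnerProductSpace ℂ W]
    [FiniteDimensional ℂ W] (f : W →ₗ[ℂ] W) : ℂ :=
  if h : ∀ x ∈ (LinearMap.ker f)ᗮ, f x ∈ (LinearMap.ker f)ᗮ then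
    LinearMap.det (f.restrict h)
  else 1

/-- `range d_{k-1}` as a subspace of `V k`, with the convention `d_{-1} = 0`. -/
noncomputable def rangePrev [∀ k, NormedAddCommGroup (V k)] [∀ k, InnerProductSpace ℂ (V k)]
    [∀ k, FiniteDimensional ℂ (V k)] (d : ∀ k, V k →ₗ[ℂ] V (k + 1)) :
    ∀ k, Submodule ℂ (V k)
  | 0 => ⊥
  | k + 1 => LinearMap.range (d k)

/-- `ker d_{k-1}†` as a subspace of `V k`, with the convention `d_{-1} = 0`. -/
noncomputable def kerAdjPrev [∀ k, NormedAddCommGroup (V k)] [∀ k, InnerProductSpace ℂ (V k)]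
    [∀ k, FiniteDimensional ℂ (V k)] (d : ∀ k, V k →ₗ[ℂ] V (k + 1)) :
    ∀ k, Submodule ℂ (V k)
  | 0 => ⊤
  | k + 1 => LinearMap.ker (LinearMap.adjoint (d k))

theorem LinearMap.IsSymmetric.map_mem_orthogonal_ker {W : Type*} [NormedAddCommGroup W]
    [InnerProductSpace ℂ W] {f : W →ₗ[ℂ] W} (hf : f.IsSymmetric) :
    ∀ x ∈ (LinearMap.ker f)ᗮ, f x ∈ (LinearMap.ker f)ᗮ := by
  intro x _ y hy
  rw [← hf y x, LinearMap.mem_ker.mp hy, inner_zero_left]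

section Determinants

variable {W W' : Type} [NormedAddCommGroup W] [InnerProductSpace ℂ W] [FiniteDimensional ℂ W]
  [NormedAddCommGroup W'] [InnerProductSpace ℂ W'] [FiniteDimensional ℂ W']

theorem LinearMap.det_eq_det_restrict_mul_det_restrict {f : W →ₗ[ℂ] W} {p q : Submodule ℂ W}
    (h : IsCompl p q) (hp : ∀ x ∈ p, f x ∈ p) (hq : ∀ x ∈ q, f x ∈ q) :
    LinearMap.det f = LinearMap.det (f.restrict hp) * LinearMap.det (f.restrict hq) := by
  rw [← LinearMap.det_prodMap,
    ← LinearMap.det_conj ((f.restrict hp).prodMap (f.restrict hq))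
      (Submodule.prodEquivOfIsCompl p q h)]
  congr 1
  ext x
  obtain ⟨y, rfl⟩ := (Submodule.prodEquivOfIsCompl p q h).surjective x
  simp

theorem detPrime_eq_det_restrict {f : W →ₗ[ℂ] W}
    (h : ∀ x ∈ (LinearMap.ker f)ᗮ, f x ∈ (LinearMap.ker f)ᗮ) :
    detPrime f = LinearMap.det (f.restrict h) :=
  dif_pos h

open ComplexOrder in
theorem LinearMap.IsPositive.detPrime_pos {f : W →ₗ[ℂ] W} (hf : f.IsPositive) :
    0 < detPrime f := by
  have h := hf.isSymmetric.map_mem_orthogonal_ker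
  rw [detPrime_eq_det_restrict h]
  have hpos : (f.restrict h).IsPositive :=
    ⟨hf.isSymmetric.restrict_invariant h, fun x => hf.2 x⟩
  have hker : LinearMap.ker (f.restrict h) = ⊥ := by
    refine LinearMap.ker_eq_bot'.mpr fun x hx => ?_
    have hx' : (x : W) ∈ LinearMap.ker f := congrArg Subtype.val hx
    exact Subtype.ext (inner_self_eq_zero.mp (x.2 x hx'))
  refine lt_of_le_of_ne ?_ fun h0 => LinearMap.det_eq_zero_iff_ker_ne_bot.mp h0.symm hker
  let b := stdOrthonormalBasis ℂ (LinearMap.ker f)ᗮ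
  rw [← LinearMap.det_toMatrix b.toBasis]
  exact ((LinearMap.posSemidef_toMatrix_iff b).mpr hpos).det_nonneg

theorem LinearMap.IsPositive.im_detPrime_eq_zero {f : W →ₗ[ℂ] W} (hf : f.IsPositive) :
    (detPrime f).im = 0 :=
  (Complex.pos_iff.mp hf.detPrime_pos).2.symm

theorem LinearMap.IsPositive.re_detPrime_pos {f : W →ₗ[ℂ] W} (hf : f.IsPositive) :
    0 < (detPrime f).re :=
  (Complex.pos_iff.mp hf.detPrime_pos).1

theorem LinearMap.det_add_eq_detPrime_mul_detPrime {f g : W →ₗ[ℂ] W} (hf : f.IsSymmetric)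
    (hg : g.IsSymmetric) (h : LinearMap.ker g = (LinearMap.ker f)ᗮ) :
    LinearMap.det (f + g) = detPrime f * detPrime g := by
  have h' : LinearMap.ker f = (LinearMap.ker g)ᗮ := by
    rw [h, Submodule.orthogonal_orthogonal]
  have hf₁ := hf.map_mem_orthogonal_ker
  have hg₁ := hg.map_mem_orthogonal_ker
  have hfg : ∀ x ∈ (LinearMap.ker f)ᗮ, (f + g) x = f x := fun x hx => by
    rw [← h] at hx
    simp [LinearMap.mem_ker.mp hx]
  have hgf : ∀ x ∈ (LinearMap.ker g)ᗮ, (f + g) x = g x := fun x hx => by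
    rw [← h'] at hx
    simp [LinearMap.mem_ker.mp hx]
  have hp : ∀ x ∈ (LinearMap.ker f)ᗮ, (f + g) x ∈ (LinearMap.ker f)ᗮ := fun x hx => by
    rw [hfg x hx]
    exact hf₁ x hx
  have hq : ∀ x ∈ (LinearMap.ker g)ᗮ, (f + g) x ∈ (LinearMap.ker g)ᗮ := fun x hx => by
    rw [hgf x hx]
    exact hg₁ x hx
  have hc : IsCompl (LinearMap.ker f)ᗮ (LinearMap.ker g)ᗮ := by
    rw [← h']
    exact (Submodule.isCompl_orthogonal (LinearMap.ker f)).symm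
  rw [LinearMap.det_eq_det_restrict_mul_det_restrict hc hp hq, detPrime_eq_det_restrict hf₁,
    detPrime_eq_det_restrict hg₁]
  congr 2
  · ext x
    exact hfg x x.2
  · ext x
    exact hgf x x.2

theorem detPrime_self_comp_adjoint (f : W →ₗ[ℂ] W') :
    detPrime (f.comp (LinearMap.adjoint f)) = detPrime ((LinearMap.adjoint f).comp f) := by
  have h₁ := f.isPositive_adjoint_comp_self.isSymmetric.map_mem_orthogonal_ker
  have h₂ := f.isPositive_self_comp_adjoint.isSymmetric.map_mem_orthogonal_ker
  have hk₁ : (LinearMap.ker ((LinearMap.adjoint f).comp f))ᗮ = (LinearMap.ker f)ᗮ := by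
    rw [LinearMap.ker_adjoint_comp_self]
  have hk₂ : (LinearMap.ker (f.comp (LinearMap.adjoint f)))ᗮ = LinearMap.range f := by
    rw [LinearMap.ker_self_comp_adjoint, LinearMap.orthogonal_ker, LinearMap.adjoint_adjoint]
  let g : (LinearMap.ker ((LinearMap.adjoint f).comp f))ᗮ →ₗ[ℂ]
      (LinearMap.ker (f.comp (LinearMap.adjoint f)))ᗮ :=
    f.restrict fun x _ => hk₂ ▸ LinearMap.mem_range_self f x
  have hg : Function.Bijective g := by
    constructor
    · refine LinearMap.ker_eq_bot.mp (LinearMap.ker_eq_bot'.mpr fun x hx => ?_)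
      have hx' : (x : W) ∈ LinearMap.ker f := congrArg Subtype.val hx
      exact Subtype.ext (inner_self_eq_zero.mp (hk₁.le x.2 x hx'))
    · rintro ⟨y, hy⟩
      obtain ⟨x, rfl⟩ : y ∈ LinearMap.range f := hk₂ ▸ hy
      obtain ⟨u, hu, v, hv, rfl⟩ := (LinearMap.ker f).exists_add_mem_mem_orthogonal x
      refine ⟨⟨v, hk₁ ▸ hv⟩, Subtype.ext ?_⟩
      simp [g, LinearMap.mem_ker.mp hu]
  rw [detPrime_eq_det_restrict h₁, detPrime_eq_det_restrict h₂,
    ← LinearMap.det_conj _ (LinearEquiv.ofBijective g hg)]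
  congr 1
  ext x
  obtain ⟨y, rfl⟩ := (LinearEquiv.ofBijective g hg).surjective x
  simp [g]

theorem detPrime_zero : detPrime (0 : W →ₗ[ℂ] W) = 1 := by
  rw [detPrime_eq_det_restrict LinearMap.IsSymmetric.zero.map_mem_orthogonal_ker]
  refine LinearMap.det_eq_one_of_finrank_eq_zero ?_ _
  simp

end Determinants

section Products

theorem Finset.prod_Icc_one_reflect {M : Type*} [CommMonoid M] (f : ℕ → M) (k : ℕ) :
    ∏ j ∈ Finset.Icc 1 k, f (k - j) = ∏ m ∈ Finset.range k, f m := by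
  refine Finset.prod_bij' (fun j _ => k - j) (fun m _ => k - m) ?_ ?_ ?_ ?_ ?_ <;>
    simp <;> omega

variable {D L : ℕ → ℝ}

theorem prod_rpow_alternating_telescope (hD : ∀ m, 0 < D m)
    (hL : ∀ m, L (m + 1) = D m * D (m + 1)) (n : ℕ) :
    ∏ m ∈ Finset.range (n + 1), L m ^ ((-1 : ℝ) ^ m * (m : ℝ) / 2) =
      (∏ m ∈ Finset.range n, D m ^ (-(-1 : ℝ) ^ m / 2)) * D n ^ ((-1 : ℝ) ^ n * (n : ℝ) / 2) := by
  induction n with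
  | zero => simp
  | succ n ih =>
    rw [Finset.prod_range_succ, ih, Finset.prod_range_succ, hL,
      Real.mul_rpow (hD n).le (hD (n + 1)).le, mul_assoc, ← mul_assoc (D n ^ _),
      ← Real.rpow_add (hD n), mul_assoc]
    congr 4
    push_cast
    ring

theorem prod_mul_inv_prod_eq_prod_rpow (hD : ∀ m, 0 < D m)
    (hL : ∀ m, L (m + 1) = D m * D (m + 1)) {n k : ℕ} (hk : k ≤ n) (hn : D n = 1) :
    (∏ j ∈ Finset.Icc 1 k, D (k - j) ^ ((-1 : ℝ) ^ j / 2)) *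
        (∏ j ∈ Finset.range (n - k), D (k + j) ^ ((-1 : ℝ) ^ (j + 1) / 2))⁻¹ =
      (∏ m ∈ Finset.range (n + 1), L m ^ ((-1 : ℝ) ^ m * (m : ℝ) / 2)) ^
        ((-1 : ℝ) ^ (k + 1)) := by
  have hsq : ((-1 : ℝ) ^ k) * (-1) ^ k = 1 := by rw [← mul_pow]; simp
  have hZ : ∏ j ∈ Finset.Icc 1 k, D (k - j) ^ ((-1 : ℝ) ^ j / 2) =
      ∏ m ∈ Finset.range k, D m ^ ((-1 : ℝ) ^ (k + m) / 2) := by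
    rw [← Finset.prod_Icc_one_reflect]
    refine Finset.prod_congr rfl fun j hj => ?_
    obtain ⟨i, rfl⟩ := Nat.exists_eq_add_of_le (Finset.mem_Icc.mp hj).2
    rw [Nat.add_sub_cancel_left, show j + i + i = j + 2 * i by ring, pow_add, pow_mul]
    simp
  have hZ' : (∏ j ∈ Finset.range (n - k), D (k + j) ^ ((-1 : ℝ) ^ (j + 1) / 2))⁻¹ =
      ∏ j ∈ Finset.range (n - k), D (k + j) ^ ((-1 : ℝ) ^ (k + (k + j)) / 2) := by
    rw [← Finset.prod_inv_distrib]
    refine Finset.prod_congr rfl fun j _ => ?_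
    rw [← Real.rpow_neg (hD _).le]
    congr 1
    rw [pow_add _ k, pow_add _ k, ← mul_assoc, hsq]
    ring
  rw [hZ, hZ', ← Finset.prod_range_add, Nat.add_sub_cancel' hk,
    prod_rpow_alternating_telescope hD hL, hn, Real.one_rpow, mul_one,
    ← Real.finsetProd_rpow _ _ fun m _ => (Real.rpow_pos_of_pos (hD m) _).le]
  refine Finset.prod_congr rfl fun m _ => ?_
  rw [← Real.rpow_mul (hD m).le]
  congr 1
  ring

end Products

section Complexes

variable [∀ k, NormedAddCommGroup (V k)] [∀ k, InnerProductSpace ℂ (V k)]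
  [∀ k, FiniteDimensional ℂ (V k)] (d : ∀ k, V k →ₗ[ℂ] V (k + 1))

theorem ddAdj_isPositive : ∀ m, (ddAdj d m).IsPositive
  | 0 => LinearMap.isPositive_zero
  | m + 1 => (d m).isPositive_self_comp_adjoint

theorem detPrime_ddAdj_succ (m : ℕ) :
    detPrime (ddAdj d (m + 1)) = detPrime ((LinearMap.adjoint (d m)).comp (d m)) :=
  detPrime_self_comp_adjoint (d m)

variable {d}

theorem det_Lap_zero (h : LinearMap.ker (d 0) = ⊥) :
    LinearMap.det (Lap d 0) = detPrime ((LinearMap.adjoint (d 0)).comp (d 0)) := by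
  have hs := (d 0).isPositive_adjoint_comp_self.isSymmetric
  rw [Lap, ddAdj, LinearMap.det_add_eq_detPrime_mul_detPrime LinearMap.IsSymmetric.zero hs
    (by rw [LinearMap.ker_adjoint_comp_self, h]; simp), detPrime_zero, one_mul]

theorem det_Lap_succ {m : ℕ} (h : LinearMap.ker (d (m + 1)) = LinearMap.range (d m)) :
    LinearMap.det (Lap d (m + 1)) = detPrime ((LinearMap.adjoint (d m)).comp (d m)) *
      detPrime ((LinearMap.adjoint (d (m + 1))).comp (d (m + 1))) := by
  rw [← detPrime_ddAdj_succ, Lap]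
  refine LinearMap.det_add_eq_detPrime_mul_detPrime (ddAdj_isPositive d _).isSymmetric
    (d (m + 1)).isPositive_adjoint_comp_self.isSymmetric ?_
  rw [LinearMap.ker_adjoint_comp_self, h, ddAdj, LinearMap.ker_self_comp_adjoint,
    LinearMap.orthogonal_ker, LinearMap.adjoint_adjoint]

end Complexes

/-- For an acyclic complex of finite-dimensional complex inner product
spaces and `0 ≤ k ≤ n`, all determinants appearing below are positive real numbers, and
with (Schwarz's partition functions and the torsion, real powers throughout)
`Z = ∏_{j=1}^{k} det′(d_{k−j}† ∘ d_{k−j})^{(−1)^j/2}`,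
`Z* = ∏_{j=0}^{n−k−1} det′(d_{k+j} ∘ d_{k+j}†)^{(−1)^{j+1}/2}`,
`T = ∏_{m=0}^{n} (det Δ_m)^{(−1)^m·m/2}`, one has `Z · Z*⁻¹ = T^{(−1)^{k+1}}`. -/
theorem stmt16 [∀ k, NormedAddCommGroup (V k)] [∀ k, InnerProductSpace ℂ (V k)]
    [∀ k, FiniteDimensional ℂ (V k)]
    (n : ℕ) (d : ∀ k, V k →ₗ[ℂ] V (k + 1))
    (hcomp : ∀ k, (d (k + 1)).comp (d k) = 0)
    (hzero : ∀ k, n ≤ k → d k = 0)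
    (hker0 : LinearMap.ker (d 0) = ⊥)
    (hacyc : ∀ k, k < n → LinearMap.ker (d (k + 1)) = LinearMap.range (d k))
    (k : ℕ) (hk : k ≤ n) :
    (∀ m ≤ n, (LinearMap.det (Lap d m)).im = 0 ∧ 0 < (LinearMap.det (Lap d m)).re) ∧
    (∀ j ∈ Finset.Icc 1 k,
      (detPrime ((LinearMap.adjoint (d (k - j))).comp (d (k - j)))).im = 0 ∧
      0 < (detPrime ((LinearMap.adjoint (d (k - j))).comp (d (k - j)))).re) ∧
    (∀ j ∈ Finset.range (n - k),
      (detPrime (ddAdj d (k + j + 1))).im = 0 ∧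
      0 < (detPrime (ddAdj d (k + j + 1))).re) ∧
    (∏ j ∈ Finset.Icc 1 k,
        (detPrime ((LinearMap.adjoint (d (k - j))).comp (d (k - j)))).re ^
          ((-1 : ℝ) ^ j / 2)) *
      (∏ j ∈ Finset.range (n - k),
        (detPrime (ddAdj d (k + j + 1))).re ^ ((-1 : ℝ) ^ (j + 1) / 2))⁻¹ =
      (∏ m ∈ Finset.range (n + 1),
        (LinearMap.det (Lap d m)).re ^ ((-1 : ℝ) ^ m * (m : ℝ) / 2)) ^
        ((-1 : ℝ) ^ (k + 1)) := by
  let D : ℕ → ℝ := fun m => (detPrime ((LinearMap.adjoint (d m)).comp (d m))).re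
  have hDim m : (detPrime ((LinearMap.adjoint (d m)).comp (d m))).im = 0 :=
    (d m).isPositive_adjoint_comp_self.im_detPrime_eq_zero
  have hD m : 0 < D m := (d m).isPositive_adjoint_comp_self.re_detPrime_pos
  have hDn : D n = 1 := by simp [D, hzero n le_rfl, detPrime_zero]
  -- Beyond degree `n` the Laplacian is not controlled, so `L` is only compared with it up to `n`.
  let L : ℕ → ℝ
    | 0 => D 0
    | m + 1 => D m * D (m + 1)
  have hLpos : ∀ m, 0 < L m
    | 0 => hD 0
    | m + 1 => mul_pos (hD m) (hD (m + 1))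
  have hLap : ∀ m ≤ n, (LinearMap.det (Lap d m)).im = 0 ∧ (LinearMap.det (Lap d m)).re = L m := by
    rintro (_ | m) hm
    · rw [det_Lap_zero hker0]
      exact ⟨hDim 0, rfl⟩
    · rw [det_Lap_succ (hacyc m hm)]
      simp [Complex.mul_im, Complex.mul_re, hDim, L, D]
  refine ⟨fun m hm => ⟨(hLap m hm).1, (hLap m hm).2 ▸ hLpos m⟩, fun j _ => ⟨hDim _, hD _⟩,
    fun j _ => ⟨(ddAdj_isPositive d _).im_detPrime_eq_zero,
      (ddAdj_isPositive d _).re_detPrime_pos⟩, ?_⟩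
  simp only [detPrime_ddAdj_succ]
  convert prod_mul_inv_prod_eq_prod_rpow hD (L := L) (fun _ => rfl) hk hDn using 3 with m hm
  rw [(hLap m (Finset.mem_range_succ_iff.mp hm)).2]
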